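/- Let G be a finite simple graph, let R and C be disjoint finite vertex sets, and let u ∈ C be a vertex such that R ∪ {u} is an s-plex. Suppose that every vertex v ∈ R \ N(u) satisfies m̄(v, R ∪ C) ≤ s − 1, and set C₁ = N(u) ∩ C. Then u is a pivot vertex: for every subset H ⊆ C₁ such that R ∪ H is an s-plex, the set R ∪ H ∪ {u} is also an s-plex. -/

import Mathlib

open Finset

variable {V : Type*} [Fintype V] [DecidableEq V]

/-- `E(Q)`: the edges of `G` with both endpoints in `Q`. -/
def edgesIn (G : SimpleGraph V) [DecidableRel G.Adj] (Q : Finset V) : Finset (Sym2 V) :=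
  G.edgeFinset ∩ Q.sym2

/-- `m̄(Q) = C(|Q|,2) - |E(Q)|`: the number of missing edges of `Q`. -/
def mbar (G : SimpleGraph V) [DecidableRel G.Adj] (Q : Finset V) : ℕ :=
  Q.card.choose 2 - (edgesIn G Q).card

/-- `m̄(u,Q) = |Q \ {u}| - |N(u) ∩ Q|`: the number of non-neighbors of `u` in `Q \ {u}`. -/
def mbarV (G : SimpleGraph V) [DecidableRel G.Adj] (u : V) (Q : Finset V) : ℕ :=
  (Q.erase u).card - (Q.filter (fun v => G.Adj u v)).card

/-- `m̄(u,Q)` counts the vertices of `Q` other than `u` that are not adjacent to `u`. -/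
theorem mbarV_eq_card_filter (G : SimpleGraph V) [DecidableRel G.Adj] (u : V) (Q : Finset V) :
    mbarV G u Q = (Q.filter (fun v => v ≠ u ∧ ¬ G.Adj u v)).card := by
  have hsub : Q.filter (fun v => G.Adj u v) ⊆ Q.erase u := by
    intro v hv
    rw [mem_filter] at hv
    exact mem_erase.2 ⟨hv.2.ne', hv.1⟩
  rw [mbarV, ← card_sdiff_of_subset hsub]
  congr 1
  ext v
  simp only [mem_sdiff, mem_erase, mem_filter]
  tauto

/-- `m̄(w,P) ≤ m̄(w,Q)` when `Q` contains every non-neighbor of `w` in `P`. -/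
theorem mbarV_le_of_forall_mem (G : SimpleGraph V) [DecidableRel G.Adj] {w : V} {P Q : Finset V}
    (h : ∀ v ∈ P, v ≠ w → ¬ G.Adj w v → v ∈ Q) : mbarV G w P ≤ mbarV G w Q := by
  rw [mbarV_eq_card_filter, mbarV_eq_card_filter]
  apply card_le_card
  intro v hv
  rw [mem_filter] at hv ⊢
  exact ⟨h v hv.1 hv.2.1 hv.2.2, hv.2⟩

theorem plex_pivot_coarse (G : SimpleGraph V) [DecidableRel G.Adj]
    (s : ℕ) (R C : Finset V) (u : V) (hdisj : Disjoint R C) (hu : u ∈ C)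
    (hRu : ∀ w ∈ insert u R, mbarV G w (insert u R) ≤ s)
    (hcond : ∀ v ∈ R, ¬ G.Adj u v → mbarV G v (R ∪ C) + 1 ≤ s)
    (C₁ : Finset V) (hC₁ : C₁ = C.filter (fun v => G.Adj u v)) :
    ∀ H ⊆ C₁, (∀ w ∈ R ∪ H, mbarV G w (R ∪ H) ≤ s) →
      ∀ w ∈ insert u (R ∪ H), mbarV G w (insert u (R ∪ H)) ≤ s := by
  subst hC₁
  intro H hH hRH w hw
  have hHC : ∀ v ∈ H, v ∈ C ∧ G.Adj u v := fun v hv => mem_filter.1 (hH hv)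
  by_cases hwu : w = u
  · subst hwu
    refine (mbarV_le_of_forall_mem G ?_).trans (hRu w (mem_insert_self w R))
    intro v hv hne hadj
    have := hHC v
    simp only [mem_insert, mem_union] at hv ⊢
    tauto
  have hwRH : w ∈ R ∪ H := mem_of_mem_insert_of_ne hw hwu
  by_cases huw : G.Adj u w
  · refine (mbarV_le_of_forall_mem G ?_).trans (hRH w hwRH)
    intro v hv _ hadj
    refine mem_of_mem_insert_of_ne hv ?_
    rintro rfl
    exact hadj huw.symm
  · have hwR : w ∈ R := (mem_union.1 hwRH).resolve_right fun h => huw (hHC w h).2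
    refine (mbarV_le_of_forall_mem G ?_).trans (Nat.le_of_succ_le (hcond w hwR huw))
    intro v hv _ _
    have := hHC v
    simp only [mem_insert, mem_union] at hv ⊢
    rcases hv with rfl | hv | hv
    · exact Or.inr hu
    · exact Or.inl hv
    · exact Or.inr (this hv).1
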